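/- arXiv:2009.10988 — 2 statements merged into one kernel-verified Lean document; each statement's English description precedes it below -/
import Mathlib

section
/- There exists a constant c > 0 such that for every n and every stable tree T of the tree connection game with n agents, SC(T) ≥ (7/5)·n − c. Consequently, the Price of Stability of the tree connection game is at least 7/5 − ε, where ε ∈ Θ(1/n). -/
open Function
open scoped ENNReal Classical

noncomputable section

namespace TCG

variable {n : ℕ}

/-- In-degree of node `v` in the network induced by profile `s` with root `r`:
the number of activated edges `(u, v)` with `u` an agent (a non-root node). -/
def indeg (r : Fin (n + 1)) (s : Fin (n + 1) → Fin (n + 1)) (v : Fin (n + 1)) : ℕ :=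
  Nat.card {u : Fin (n + 1) | u ≠ r ∧ s u = v}

/-- `|T(u)|`: the number of nodes having a directed path to `u` (including `u` itself). -/
def subtreeSize (s : Fin (n + 1) → Fin (n + 1)) (u : Fin (n + 1)) : ℕ :=
  Nat.card {w : Fin (n + 1) | ∃ k, s^[k] w = u}

/-- Cost of the agent at node `v` with respect to the root `r`:
the sum, over the edges `(u, u')` of the unique directed path from `v` to `r`,
of `indeg(u') / |T(u)|`; the cost is `∞` if no such path exists. -/
def cost (r : Fin (n + 1)) (s : Fin (n + 1) → Fin (n + 1)) (v : Fin (n + 1)) : ℝ≥0∞ :=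
  if h : ∃ k, s^[k] v = r then
    ∑ k ∈ Finset.range (Nat.find h),
      (indeg r s (s^[k + 1] v) : ℝ≥0∞) / (subtreeSize s (s^[k] v) : ℝ≥0∞)
  else ⊤

/-- A valid strategy profile: the root is absorbing (a formal convention encoding that the
root activates no edge), and every agent chooses a node different from herself. -/
def ValidProfile (r : Fin (n + 1)) (s : Fin (n + 1) → Fin (n + 1)) : Prop :=
  s r = r ∧ ∀ v, v ≠ r → s v ≠ v

/-- Pure Nash equilibrium (the induced network is *stable*): no agent can strictly
decrease her cost by unilaterally switching her activated edge to another node. -/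
def IsStable (r : Fin (n + 1)) (s : Fin (n + 1) → Fin (n + 1)) : Prop :=
  ValidProfile r s ∧
    ∀ v, v ≠ r → ∀ w, w ≠ v → cost r s v ≤ cost r (Function.update s v w) v

/-- Social cost: the sum of the costs of all agents (the non-root nodes). -/
def SC (s : Fin (n + 1) → Fin (n + 1)) : ℝ≥0∞ :=
  ∑ v ∈ Finset.univ.erase (0 : Fin (n + 1)), cost 0 s v

/-- Height of the induced network: the maximum length of a (leaf-to-)root path,
i.e. the least `k` such that every node arrives at the root after `k` steps. -/
def height (s : Fin (n + 1) → Fin (n + 1)) : ℕ :=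
  sInf {k | ∀ v, s^[k] v = 0}

/-- Fairness Ratio: maximum agent cost divided by minimum agent cost. -/
def FR (s : Fin (n + 1) → Fin (n + 1)) : ℝ≥0∞ :=
  (⨆ (v : Fin (n + 1)) (_ : v ≠ 0), cost 0 s v) /
    (⨅ (v : Fin (n + 1)) (_ : v ≠ 0), cost 0 s v)

lemma iterate_zero_of_map_zero {s : Fin (n + 1) → Fin (n + 1)} (h0 : s 0 = 0) (k : ℕ) :
    s^[k] 0 = 0 :=
  Function.iterate_fixed h0 k

lemma eq_zero_of_iterate_succ_eq {s : Fin (n + 1) → Fin (n + 1)} (h0 : s 0 = 0)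
    (hr : ∀ v, ∃ k, s^[k] v = 0) {c : Fin (n + 1)} {j : ℕ} (h : s^[j + 1] c = c) : c = 0 := by
  obtain ⟨N, hN⟩ := hr c
  have h1 : s^[(j + 1) * N] c = c := by
    rw [Function.iterate_mul]
    exact Function.iterate_fixed h N
  have h2 : s^[(j + 1) * N] c = 0 := by
    rw [add_mul, one_mul, Function.iterate_add_apply, hN, iterate_zero_of_map_zero h0]
  exact h1.symm.trans h2

lemma subtreeSize_pos (s : Fin (n + 1) → Fin (n + 1)) (u : Fin (n + 1)) :
    0 < subtreeSize s u := by
  have : Nonempty {w : Fin (n + 1) | ∃ k, s^[k] w = u} := ⟨⟨u, 0, rfl⟩⟩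
  exact Nat.card_pos

lemma cost_zero (s : Fin (n + 1) → Fin (n + 1)) : cost 0 s 0 = 0 := by
  have h : ∃ k, s^[k] (0 : Fin (n + 1)) = 0 := ⟨0, rfl⟩
  rw [cost, dif_pos h, (Nat.find_eq_zero h).2 rfl]
  simp

lemma cost_eq_add {s : Fin (n + 1) → Fin (n + 1)} {v : Fin (n + 1)} (hv : v ≠ 0)
    (hr : ∃ k, s^[k] (s v) = 0) :
    cost 0 s v = (indeg 0 s (s v) : ℝ≥0∞) / (subtreeSize s v : ℝ≥0∞) + cost 0 s (s v) := by
  have h : ∃ k, s^[k] v = 0 := by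
    obtain ⟨k, hk⟩ := hr
    exact ⟨k + 1, hk⟩
  rw [cost, cost, dif_pos h, dif_pos hr, Nat.find_comp_succ h hr hv, Finset.sum_range_succ']
  rw [add_comm]
  rfl

lemma indeg_div_subtreeSize_ne_top (s : Fin (n + 1) → Fin (n + 1)) (u v : Fin (n + 1)) :
    (indeg 0 s u : ℝ≥0∞) / (subtreeSize s v : ℝ≥0∞) ≠ ⊤ :=
  ENNReal.div_ne_top (ENNReal.natCast_ne_top _) (by exact_mod_cast (subtreeSize_pos s v).ne')

lemma cost_ne_top {s : Fin (n + 1) → Fin (n + 1)} {v : Fin (n + 1)}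
    (hr : ∃ k, s^[k] v = 0) : cost 0 s v ≠ ⊤ := by
  rw [cost, dif_pos hr]
  exact ENNReal.sum_ne_top.2 fun k _ => indeg_div_subtreeSize_ne_top s _ _

lemma cost_map_le {s : Fin (n + 1) → Fin (n + 1)} (h0 : s 0 = 0)
    (hr : ∀ v, ∃ k, s^[k] v = 0) (v : Fin (n + 1)) : cost 0 s (s v) ≤ cost 0 s v := by
  by_cases hv : v = 0
  · rw [hv, h0]
  · rw [cost_eq_add hv (hr _)]
    exact le_add_self

lemma cost_iterate_le {s : Fin (n + 1) → Fin (n + 1)} (h0 : s 0 = 0)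
    (hr : ∀ v, ∃ k, s^[k] v = 0) (v : Fin (n + 1)) (j : ℕ) :
    cost 0 s (s^[j] v) ≤ cost 0 s v := by
  induction j with
  | zero => exact le_rfl
  | succ j ih =>
    rw [Function.iterate_succ_apply']
    exact (cost_map_le h0 hr _).trans ih

lemma indeg_eq_card (s : Fin (n + 1) → Fin (n + 1)) (v : Fin (n + 1)) :
    indeg 0 s v = ((Finset.univ.erase (0 : Fin (n + 1))).filter fun u => s u = v).card := by
  rw [indeg, Nat.card_coe_set_eq, Set.ncard_eq_toFinset_card']
  congr 1
  ext u
  simp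

lemma indeg_pos {s : Fin (n + 1) → Fin (n + 1)} {u : Fin (n + 1)} (hu : u ≠ 0) :
    0 < indeg 0 s (s u) := by
  rw [indeg_eq_card, Finset.card_pos]
  exact ⟨u, by simp [hu]⟩

lemma exists_of_indeg_pos {s : Fin (n + 1) → Fin (n + 1)} {v : Fin (n + 1)}
    (h : 0 < indeg 0 s v) : ∃ u, u ≠ 0 ∧ s u = v := by
  rw [indeg_eq_card, Finset.card_pos] at h
  obtain ⟨u, hu⟩ := h
  exact ⟨u, by simpa using hu⟩

lemma sum_indeg (s : Fin (n + 1) → Fin (n + 1)) : ∑ v, indeg 0 s v = n := by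
  simp_rw [indeg_eq_card]
  rw [← Finset.card_eq_sum_card_fiberwise (fun x _ => Finset.mem_coe.2 (Finset.mem_univ (s x)))]
  simp

lemma sum_indeg_map (s : Fin (n + 1) → Fin (n + 1)) :
    ∑ u ∈ Finset.univ.erase (0 : Fin (n + 1)), indeg 0 s (s u) = ∑ v, indeg 0 s v ^ 2 := by
  rw [← Finset.sum_fiberwise (Finset.univ.erase (0 : Fin (n + 1))) s]
  refine Finset.sum_congr rfl fun v _ => ?_
  rw [Finset.sum_congr rfl (g := fun _ => indeg 0 s v)
    (fun u hu => by rw [(Finset.mem_filter.1 hu).2]), Finset.sum_const, ← indeg_eq_card,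
    smul_eq_mul, sq]

lemma subtreeSize_eq_card (s : Fin (n + 1) → Fin (n + 1)) (u : Fin (n + 1)) :
    subtreeSize s u = (Finset.univ.filter fun w => ∃ k, s^[k] w = u).card := by
  rw [subtreeSize, Nat.card_coe_set_eq, Set.ncard_eq_toFinset_card']
  congr 1
  ext u
  simp

lemma cost_eq_sum {s : Fin (n + 1) → Fin (n + 1)} (h0 : s 0 = 0)
    (hr : ∀ v, ∃ k, s^[k] v = 0) (v : Fin (n + 1)) :
    cost 0 s v = ∑ u ∈ Finset.univ.erase (0 : Fin (n + 1)),
      if ∃ k, s^[k] v = u then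
        (indeg 0 s (s u) : ℝ≥0∞) / (subtreeSize s u : ℝ≥0∞) else 0 := by
  obtain ⟨N, hN⟩ := hr v
  induction N generalizing v with
  | zero =>
    obtain rfl : v = 0 := hN
    rw [cost_zero, Finset.sum_eq_zero]
    intro u hu
    rw [if_neg]
    rintro ⟨k, hk⟩
    rw [iterate_zero_of_map_zero h0] at hk
    exact Finset.ne_of_mem_erase hu hk.symm
  | succ N ih =>
    by_cases hv : v = 0
    · exact ih v (by rw [hv, iterate_zero_of_map_zero h0])
    have hmem : v ∈ Finset.univ.erase (0 : Fin (n + 1)) := by simp [hv]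
    rw [cost_eq_add hv (hr _), ih (s v) hN, ← Finset.add_sum_erase _ _ hmem,
      ← Finset.add_sum_erase (Finset.univ.erase (0 : Fin (n + 1)))
        (fun u => if ∃ k, s^[k] v = u then _ else _) hmem]
    have hcyc : ¬ ∃ k, s^[k] (s v) = v := by
      rintro ⟨k, hk⟩
      exact hv (eq_zero_of_iterate_succ_eq h0 hr (j := k) hk)
    rw [if_neg hcyc, zero_add, if_pos ⟨0, rfl⟩]
    congr 1
    refine Finset.sum_congr rfl fun u hu => ?_
    have huv : u ≠ v := Finset.ne_of_mem_erase hu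
    refine if_congr ⟨?_, ?_⟩ rfl rfl
    · rintro ⟨k, hk⟩
      exact ⟨k + 1, hk⟩
    · rintro ⟨k, hk⟩
      cases k with
      | zero => exact absurd hk.symm huv
      | succ k => exact ⟨k, hk⟩

lemma SC_eq_sum_sq {s : Fin (n + 1) → Fin (n + 1)} (h0 : s 0 = 0)
    (hr : ∀ v, ∃ k, s^[k] v = 0) : SC s = ((∑ v, indeg 0 s v ^ 2 : ℕ) : ℝ≥0∞) := by
  have h : SC s = ∑ v, cost 0 s v := by
    rw [SC, ← Finset.add_sum_erase _ _ (Finset.mem_univ (0 : Fin (n + 1))), cost_zero, zero_add]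
  rw [h, Finset.sum_congr rfl fun v _ => cost_eq_sum h0 hr v, Finset.sum_comm, ← sum_indeg_map,
    Nat.cast_sum]
  refine Finset.sum_congr rfl fun u _ => ?_
  rw [← Finset.sum_filter, Finset.sum_const, ← subtreeSize_eq_card, nsmul_eq_mul]
  exact ENNReal.mul_div_cancel (by exact_mod_cast (subtreeSize_pos s u).ne')
    (ENNReal.natCast_ne_top _)

lemma subtreeSize_le_one {s : Fin (n + 1) → Fin (n + 1)} (h0 : s 0 = 0) {v : Fin (n + 1)}
    (hv : v ≠ 0) (h : indeg 0 s v = 0) : subtreeSize s v ≤ 1 := by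
  rw [subtreeSize_eq_card, Finset.card_le_one_iff_subset_singleton]
  refine ⟨v, fun x hx => ?_⟩
  obtain ⟨k, hk⟩ := (Finset.mem_filter.1 hx).2
  cases k with
  | zero => exact Finset.mem_singleton.2 hk
  | succ k =>
    rw [Function.iterate_succ_apply'] at hk
    have hne : s^[k] x ≠ 0 := fun h' => hv (by rw [← hk, h', h0])
    have := indeg_pos (s := s) hne
    rw [hk] at this
    omega

lemma subtreeSize_map_le {s : Fin (n + 1) → Fin (n + 1)} (h0 : s 0 = 0) {w : Fin (n + 1)}
    (hw : w ≠ 0) (hsw : s w ≠ 0) (h : indeg 0 s (s w) = 1) :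
    subtreeSize s (s w) ≤ subtreeSize s w + 1 := by
  rw [subtreeSize_eq_card, subtreeSize_eq_card]
  refine le_trans (Finset.card_le_card ?_) (Finset.card_insert_le (s w) _)
  intro x hx
  obtain ⟨k, hk⟩ := (Finset.mem_filter.1 hx).2
  cases k with
  | zero => exact Finset.mem_insert.2 (Or.inl hk)
  | succ k =>
    rw [Function.iterate_succ_apply'] at hk
    have hne : s^[k] x ≠ 0 := fun h' => hsw (by rw [← hk, h', h0])
    rw [indeg_eq_card] at h
    have hxw : s^[k] x = w :=
      Finset.card_le_one.1 h.le _ (by simp [hne, hk]) _ (by simp [hw])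
    exact Finset.mem_insert_of_mem (by simpa using ⟨k, hxw⟩)

lemma exists_leaf_below {s : Fin (n + 1) → Fin (n + 1)}
    (hr : ∀ v, ∃ k, s^[k] v = 0) {c : Fin (n + 1)} (hc : 0 < indeg 0 s c) :
    ∃ v, v ≠ 0 ∧ indeg 0 s v = 0 ∧ ∃ k, s^[k] v = c := by
  obtain ⟨x, hx0, hx⟩ := exists_of_indeg_pos hc
  obtain ⟨v, hv, hmax⟩ := Finset.exists_max_image
    ((Finset.univ.erase (0 : Fin (n + 1))).filter fun w => ∃ k, s^[k] w = c)
    (fun w => Nat.find (hr w)) ⟨x, by simpa [hx0] using ⟨1, hx⟩⟩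
  simp only [Finset.mem_filter, Finset.mem_erase, Finset.mem_univ, and_true] at hv
  obtain ⟨hv0, k, hk⟩ := hv
  refine ⟨v, hv0, ?_, k, hk⟩
  by_contra hne
  obtain ⟨y, hy0, rfl⟩ := exists_of_indeg_pos (Nat.pos_of_ne_zero hne)
  have hle := hmax y (by simpa [hy0] using ⟨k + 1, hk⟩)
  have hfind := Nat.find_comp_succ (hr y) (hr (s y)) hy0
  exact absurd (hfind.symm.trans_le hle) (Nat.not_succ_le_self _)

lemma iterate_ne_leaf {s : Fin (n + 1) → Fin (n + 1)} (h0 : s 0 = 0) {v : Fin (n + 1)}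
    (hv : v ≠ 0) (h : indeg 0 s v = 0) {x : Fin (n + 1)} (hx : x ≠ v) (k : ℕ) :
    s^[k] x ≠ v := by
  cases k with
  | zero => exact hx
  | succ k =>
    rw [Function.iterate_succ_apply']
    intro hk
    have hne : s^[k] x ≠ 0 := fun h' => hv (by rw [← hk, h', h0])
    have := indeg_pos (s := s) hne
    rw [hk] at this
    omega

lemma update_iterate {s : Fin (n + 1) → Fin (n + 1)} (h0 : s 0 = 0) {v : Fin (n + 1)}
    (hv : v ≠ 0) (h : indeg 0 s v = 0) (c : Fin (n + 1)) {x : Fin (n + 1)} (hx : x ≠ v)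
    (k : ℕ) : (Function.update s v c)^[k] x = s^[k] x := by
  induction k with
  | zero => rfl
  | succ k ih =>
    rw [Function.iterate_succ_apply', Function.iterate_succ_apply', ih,
      Function.update_of_ne (iterate_ne_leaf h0 hv h hx k)]

lemma indeg_update_le {s : Fin (n + 1) → Fin (n + 1)} {v c w : Fin (n + 1)} (hw : w ≠ c) :
    indeg 0 (Function.update s v c) w ≤ indeg 0 s w := by
  rw [indeg_eq_card, indeg_eq_card]
  refine Finset.card_le_card fun u hu => ?_
  simp only [Finset.mem_filter, Finset.mem_erase, Finset.mem_univ, and_true] at hu ⊢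
  refine ⟨hu.1, ?_⟩
  by_cases huv : u = v
  · rw [huv, Function.update_self] at hu
    exact absurd hu.2.symm hw
  · rw [Function.update_of_ne huv] at hu
    exact hu.2

lemma indeg_update_self_le (s : Fin (n + 1) → Fin (n + 1)) (v c : Fin (n + 1)) :
    indeg 0 (Function.update s v c) c ≤ indeg 0 s c + 1 := by
  rw [indeg_eq_card, indeg_eq_card]
  refine le_trans (Finset.card_le_card fun u hu => ?_) (Finset.card_insert_le v _)
  simp only [Finset.mem_insert, Finset.mem_filter, Finset.mem_erase, Finset.mem_univ,
    and_true] at hu ⊢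
  by_cases huv : u = v
  · exact Or.inl huv
  · rw [Function.update_of_ne huv] at hu
    exact Or.inr hu

lemma cost_update_iterate_le {s : Fin (n + 1) → Fin (n + 1)} (h0 : s 0 = 0)
    (hr : ∀ v, ∃ k, s^[k] v = 0) {v c : Fin (n + 1)} (hv : v ≠ 0) (h : indeg 0 s v = 0)
    (hc : c ≠ v) (N j : ℕ) (hN : s^[N] (s^[j] c) = 0) :
    cost 0 (Function.update s v c) (s^[j] c) ≤ cost 0 s (s^[j] c) := by
  induction N generalizing j with
  | zero =>
    rw [show s^[j] c = 0 from hN, cost_zero]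
    exact zero_le
  | succ N ih =>
    have hN' : s^[N] (s^[j + 1] c) = 0 := by
      rw [Function.iterate_succ_apply' s j]
      exact hN
    by_cases hu : s^[j] c = 0
    · rw [hu, cost_zero]
      exact zero_le
    have huv : s^[j] c ≠ v := iterate_ne_leaf h0 hv h hc j
    have hmap : Function.update s v c (s^[j] c) = s^[j + 1] c := by
      rw [Function.update_of_ne huv, Function.iterate_succ_apply']
    have hreach : ∃ k, (Function.update s v c)^[k] (Function.update s v c (s^[j] c)) = 0 := by
      refine ⟨N, ?_⟩
      rw [hmap, update_iterate h0 hv h c (iterate_ne_leaf h0 hv h hc (j + 1)), hN']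
    have hsc : s^[j + 1] c ≠ c := by
      intro hcyc
      have := eq_zero_of_iterate_succ_eq h0 hr hcyc
      rw [this, iterate_zero_of_map_zero h0] at hu
      exact hu rfl
    have hsize : subtreeSize s (s^[j] c) ≤ subtreeSize (Function.update s v c) (s^[j] c) := by
      rw [subtreeSize_eq_card, subtreeSize_eq_card]
      refine Finset.card_le_card fun x hx => ?_
      simp only [Finset.mem_filter, Finset.mem_univ, true_and] at hx ⊢
      by_cases hxv : x = v
      · refine ⟨j + 1, ?_⟩
        rw [hxv, Function.iterate_succ_apply, Function.update_self,
          update_iterate h0 hv h c hc]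
      · obtain ⟨k, hk⟩ := hx
        exact ⟨k, by rw [update_iterate h0 hv h c hxv, hk]⟩
    rw [cost_eq_add hu hreach, cost_eq_add hu (hr _), hmap, ← Function.iterate_succ_apply' s j]
    refine add_le_add (ENNReal.div_le_div ?_ ?_) (ih (j + 1) hN')
    · exact_mod_cast indeg_update_le hsc
    · exact_mod_cast hsize

/-- In a stable tree, a leaf cannot be more than `indeg c + 1` costlier than any other node. -/
lemma cost_leaf_le {s : Fin (n + 1) → Fin (n + 1)} (hs : IsStable 0 s)
    (hr : ∀ v, ∃ k, s^[k] v = 0) {v c : Fin (n + 1)} (hv : v ≠ 0) (h : indeg 0 s v = 0)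
    (hc : c ≠ v) : cost 0 s v ≤ (indeg 0 s c + 1 : ℕ) + cost 0 s c := by
  have h0 : s 0 = 0 := hs.1.1
  obtain ⟨N, hN⟩ := hr c
  have hreach : ∃ k, (Function.update s v c)^[k] (Function.update s v c v) = 0 :=
    ⟨N, by rw [Function.update_self, update_iterate h0 hv h c hc, hN]⟩
  refine (hs.2 v hv c hc).trans ?_
  rw [cost_eq_add hv hreach, Function.update_self]
  refine add_le_add ?_ (cost_update_iterate_le h0 hr hv h hc N 0 hN)
  calc (indeg 0 (Function.update s v c) c : ℝ≥0∞) / (subtreeSize (Function.update s v c) v : ℝ≥0∞)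
      ≤ (indeg 0 s c + 1 : ℕ) / (1 : ℕ) := by
        refine ENNReal.div_le_div ?_ ?_
        · exact_mod_cast indeg_update_self_le s v c
        · exact_mod_cast subtreeSize_pos _ v
    _ = (indeg 0 s c + 1 : ℕ) := by simp

lemma two_lt_sum_div {d₁ d₂ d₃ d₄ t₀ t₁ t₂ t₃ : ℕ} (hd₁ : 0 < d₁) (hd₂ : 0 < d₂)
    (hd₃ : 0 < d₃) (hd₄ : 0 < d₄) (ht₀ : 0 < t₀) (ht₁ : 0 < t₁) (ht₂ : 0 < t₂) (ht₃ : 0 < t₃)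
    (h₀ : t₀ ≤ 1) (h₁ : d₁ = 1 → t₁ ≤ t₀ + 1) (h₂ : d₂ = 1 → t₂ ≤ t₁ + 1)
    (h₃ : d₃ = 1 → t₃ ≤ t₂ + 1) :
    (2 : ℝ) < d₁ / t₀ + d₂ / t₁ + d₃ / t₂ + d₄ / t₃ := by
  have lower : ∀ {d t a b : ℕ}, 0 < t → a ≤ d → t ≤ b → (a : ℝ) / b ≤ d / t := by
    intro d t a b ht had htb
    gcongr
  have p₂ : (0 : ℝ) < d₂ / t₁ := by positivity
  have p₃ : (0 : ℝ) < d₃ / t₂ := by positivity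
  have p₄ : (0 : ℝ) < d₄ / t₃ := by positivity
  rcases (Nat.succ_le_of_lt hd₁).lt_or_eq with hl | he₁
  · have := lower ht₀ hl h₀
    norm_num at this
    linarith
  have q₁ := lower ht₀ hd₁ h₀
  have b₁ : t₁ ≤ 2 := by have := h₁ he₁.symm; omega
  norm_num at q₁
  rcases (Nat.succ_le_of_lt hd₂).lt_or_eq with hl | he₂
  · have := lower ht₁ hl b₁
    norm_num at this
    linarith
  have q₂ := lower ht₁ hd₂ b₁
  have b₂ : t₂ ≤ 3 := by have := h₂ he₂.symm; omega
  norm_num at q₂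
  rcases (Nat.succ_le_of_lt hd₃).lt_or_eq with hl | he₃
  · have := lower ht₂ hl b₂
    norm_num at this
    linarith
  have q₃ := lower ht₂ hd₃ b₂
  have q₄ := lower ht₃ hd₄ (show t₃ ≤ 4 by have := h₃ he₃.symm; omega)
  norm_num at q₃ q₄
  linarith

/-- In a stable tree, every node of in-degree one is at distance one, two or three from a leaf. -/
lemma exists_leaf_near {s : Fin (n + 1) → Fin (n + 1)} (hs : IsStable 0 s)
    (hr : ∀ v, ∃ k, s^[k] v = 0) {c : Fin (n + 1)} (hc : indeg 0 s c = 1) :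
    ∃ v, indeg 0 s v = 0 ∧ ∃ k < 3, s^[k + 1] v = c := by
  have h0 : s 0 = 0 := hs.1.1
  obtain ⟨v, hv0, hv, hex⟩ := exists_leaf_below hr (c := c) (by omega)
  obtain ⟨K, hK, hmin⟩ : ∃ K, s^[K] v = c ∧ ∀ i < K, s^[i] v ≠ c :=
    ⟨Nat.find hex, Nat.find_spec hex, fun i hi => Nat.find_min hex hi⟩
  have hcv : c ≠ v := by
    rintro rfl
    omega
  refine ⟨v, hv, ?_⟩
  by_contra! hfar
  have hK4 : 4 ≤ K := by
    by_contra! hlt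
    cases K with
    | zero => exact hcv hK.symm
    | succ k => exact hfar k (by omega) hK
  have hne : ∀ i < K, s^[i] v ≠ 0 := by
    intro i hi hzero
    refine hmin i hi ?_
    rw [hzero, ← hK, ← Nat.sub_add_cancel hi.le, Function.iterate_add_apply, hzero,
      iterate_zero_of_map_zero h0]
  have hle := cost_leaf_le hs hr hv0 hv hcv
  have hstep : ∀ i < K, cost 0 s (s^[i] v) =
      (indeg 0 s (s^[i + 1] v) : ℝ≥0∞) / (subtreeSize s (s^[i] v) : ℝ≥0∞)
        + cost 0 s (s^[i + 1] v) := by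
    intro i hi
    rw [cost_eq_add (hne i hi) (hr _), Function.iterate_succ_apply']
  have hrest : cost 0 s c ≤ cost 0 s (s^[4] v) := by
    have := cost_iterate_le h0 hr (s^[4] v) (K - 4)
    rwa [← Function.iterate_add_apply, Nat.sub_add_cancel hK4, hK] at this
  have hv_eq : cost 0 s v = cost 0 s (s^[0] v) := rfl
  rw [hv_eq, hstep 0 (by omega), hstep 1 (by omega), hstep 2 (by omega), hstep 3 (by omega),
    hc, ← add_assoc, ← add_assoc, ← add_assoc] at hle
  have hsum := ENNReal.le_of_add_le_add_right (cost_ne_top (hr c))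
    ((add_le_add le_rfl hrest).trans hle)
  have hreal := ENNReal.toReal_mono (ENNReal.natCast_ne_top _) hsum
  have hfin := fun i => indeg_div_subtreeSize_ne_top s (s^[i + 1] v) (s^[i] v)
  rw [ENNReal.toReal_add (by simp only [ne_eq, ENNReal.add_eq_top, not_or]; exact
      ⟨⟨hfin 0, hfin 1⟩, hfin 2⟩) (hfin 3),
    ENNReal.toReal_add (by simp only [ne_eq, ENNReal.add_eq_top, not_or]; exact
      ⟨hfin 0, hfin 1⟩) (hfin 2), ENNReal.toReal_add (hfin 0) (hfin 1)] at hreal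
  simp only [ENNReal.toReal_div, ENNReal.toReal_natCast] at hreal
  have hd : ∀ i < K, 0 < indeg 0 s (s^[i + 1] v) := by
    intro i hi
    rw [Function.iterate_succ_apply']
    exact indeg_pos (hne i hi)
  have ht : ∀ i, i + 1 < K → indeg 0 s (s^[i + 1] v) = 1 →
      subtreeSize s (s^[i + 1] v) ≤ subtreeSize s (s^[i] v) + 1 := by
    intro i hi h1
    have h2 := hne (i + 1) hi
    rw [Function.iterate_succ_apply'] at h1 h2 ⊢
    exact subtreeSize_map_le h0 (hne i (by omega)) h2 h1
  have := two_lt_sum_div (hd 0 (by omega)) (hd 1 (by omega)) (hd 2 (by omega)) (hd 3 (by omega))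
    (subtreeSize_pos s _) (subtreeSize_pos s _) (subtreeSize_pos s _) (subtreeSize_pos s _)
    (subtreeSize_le_one h0 hv0 hv) (ht 0 (by omega)) (ht 1 (by omega)) (ht 2 (by omega))
  norm_num at hreal this
  linarith

lemma card_indeg_one_le {s : Fin (n + 1) → Fin (n + 1)} (hs : IsStable 0 s)
    (hr : ∀ v, ∃ k, s^[k] v = 0) :
    (Finset.univ.filter fun v => indeg 0 s v = 1).card ≤
      3 * (Finset.univ.filter fun v => indeg 0 s v = 0).card := by
  calc (Finset.univ.filter fun v => indeg 0 s v = 1).card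
      ≤ ((Finset.range 3 ×ˢ Finset.univ.filter fun v => indeg 0 s v = 0).image
          fun p => s^[p.1 + 1] p.2).card := by
        refine Finset.card_le_card fun c hc => ?_
        obtain ⟨v, hv, k, hk, hkv⟩ := exists_leaf_near hs hr (Finset.mem_filter.1 hc).2
        exact Finset.mem_image.2 ⟨(k, v), by simp [hk, hv], hkv⟩
    _ ≤ _ := Finset.card_image_le
    _ = _ := by rw [Finset.card_product, Finset.card_range]

lemma le_sum_indeg_sq {s : Fin (n + 1) → Fin (n + 1)} (hs : IsStable 0 s)
    (hr : ∀ v, ∃ k, s^[k] v = 0) : 7 * n ≤ 5 * ∑ v, indeg 0 s v ^ 2 + 6 := by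
  have hpt : ∀ d : ℕ, 13 * d + 6 * (if d = 0 then 1 else 0) ≤
      5 * d ^ 2 + 6 + 2 * (if d = 1 then 1 else 0) := by
    intro d
    match d with
    | 0 => simp
    | 1 => simp
    | d + 2 =>
      simp
      nlinarith
  have hsum := Finset.sum_le_sum fun (v : Fin (n + 1)) (_ : v ∈ Finset.univ) => hpt (indeg 0 s v)
  simp only [Finset.sum_add_distrib, ← Finset.mul_sum, sum_indeg, ← Finset.card_filter,
    Finset.sum_const, Finset.card_univ, Fintype.card_fin, smul_eq_mul] at hsum
  have := card_indeg_one_le hs hr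
  omega

/-- There is a constant `c > 0` such that every stable tree with
`n` agents has social cost at least `(7/5)·n − c`; consequently the Price of Stability
is at least `7/5 − ε` with `ε ∈ Θ(1/n)`. -/
theorem price_of_stability_lower_bound :
    ∃ c : ℝ, 0 < c ∧
      ∀ (n : ℕ) (s : Fin (n + 1) → Fin (n + 1)),
        IsStable 0 s → (∀ v, ∃ k, s^[k] v = 0) →
        ENNReal.ofReal (7 / 5 * (n : ℝ) - c) ≤ SC s := by
  refine ⟨6 / 5, by norm_num, fun n s hs hr => ?_⟩
  rw [SC_eq_sum_sq hs.1.1 hr, ← ENNReal.ofReal_natCast]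
  refine ENNReal.ofReal_le_ofReal ?_
  have h : (7 * n : ℝ) ≤ 5 * (∑ v, indeg 0 s v ^ 2 : ℕ) + 6 := by
    exact_mod_cast le_sum_indeg_sq hs hr
  linarith

end TCG
end
end

section
/- In the tree connection game with n agents, let P be the directed Hamiltonian path r = u_0, u_1, …, u_n, where each agent at u_i activates the edge (u_i, u_{i−1}) (so u_i is at distance i from the root r). Then the Fairness Ratio of P equals n · H_n, where H_n = Σ_{i=1}^n 1/i is the n-th harmonic number: the maximum cost cost(u_n) = Σ_{i=1}^n 1/i is attained by the agent farthest from the root, and the minimum cost cost(u_1) = 1/n by the agent adjacent to the root. -/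
open Function
open scoped ENNReal Classical

noncomputable section

namespace TCG

variable {n : ℕ}

section HamiltonianPath

variable {s : Fin (n + 1) → Fin (n + 1)} {e : Fin (n + 1) ≃ Fin (n + 1)}

theorem iterate_hamiltonian_path (he0 : e 0 = 0) (hroot : s 0 = 0)
    (hpath : ∀ i : Fin n, s (e i.succ) = e i.castSucc) (k : ℕ) (j : Fin (n + 1)) :
    s^[k] (e j) = e ⟨j - k, by omega⟩ := by
  induction k generalizing j with
  | zero => simp
  | succ k ih =>
    rw [iterate_succ_apply]
    cases j using Fin.cases with
    | zero =>
      have h := ih 0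
      rw [he0] at h ⊢
      rw [hroot, h]
      simp
    | succ i =>
      rw [hpath, ih]
      congr 2
      simp only [Fin.val_castSucc, Fin.val_succ]
      omega

theorem indeg_hamiltonian_path (he0 : e 0 = 0)
    (hpath : ∀ i : Fin n, s (e i.succ) = e i.castSucc) (i : Fin n) :
    indeg 0 s (e i.castSucc) = 1 := by
  have h : {u : Fin (n + 1) | u ≠ 0 ∧ s u = e i.castSucc} = {e i.succ} := by
    ext u
    obtain ⟨j, rfl⟩ := e.surjective u
    cases j using Fin.cases with
    | zero => simp [he0, (he0 ▸ e.injective.ne (Fin.succ_ne_zero i).symm : 0 ≠ e i.succ)]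
    | succ j =>
      have hj : e j.succ ≠ 0 := he0 ▸ e.injective.ne (Fin.succ_ne_zero j)
      simp [hj, hpath]
  rw [indeg, h, Nat.card_coe_set_eq, Set.ncard_singleton]

theorem subtreeSize_hamiltonian_path (he0 : e 0 = 0) (hroot : s 0 = 0)
    (hpath : ∀ i : Fin n, s (e i.succ) = e i.castSucc) (j : Fin (n + 1)) (hj : j ≠ 0) :
    subtreeSize s (e j) = n + 1 - j := by
  have hj' : (j : ℕ) ≠ 0 := fun h => hj (Fin.ext h)
  have h : {w : Fin (n + 1) | ∃ k, s^[k] w = e j} = e '' (Finset.Ici j : Finset (Fin (n + 1))) := by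
    ext w
    obtain ⟨i, rfl⟩ := e.surjective w
    simp only [Set.mem_ofPred_eq, iterate_hamiltonian_path he0 hroot hpath, e.injective.eq_iff,
      e.injective.mem_set_image, Finset.coe_Ici, Set.mem_Ici]
    simp only [Fin.ext_iff, Fin.le_def]
    exact ⟨fun ⟨k, hk⟩ => by omega, fun hi => ⟨i - j, by omega⟩⟩
  rw [subtreeSize, h, Nat.card_coe_set_eq, Set.ncard_image_of_injective _ e.injective,
    Set.ncard_coe_finset, Fin.card_Ici]

/-- The agent at distance `j` from the root of the Hamiltonian path pays for the last `j`
edges, whose tails have subtrees of sizes `n - j + 1, …, n`. -/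
theorem cost_hamiltonian_path (he0 : e 0 = 0) (hroot : s 0 = 0)
    (hpath : ∀ i : Fin n, s (e i.succ) = e i.castSucc) (j : Fin (n + 1)) :
    cost 0 s (e j) = ∑ i ∈ Finset.Ico (n - j : ℕ) n, (1 : ℝ≥0∞) / ((i : ℝ≥0∞) + 1) := by
  have hiff (k : ℕ) : s^[k] (e j) = 0 ↔ (j : ℕ) ≤ k := by
    conv_lhs => rw [iterate_hamiltonian_path he0 hroot hpath, ← he0, e.injective.eq_iff, Fin.ext_iff]
    exact Nat.sub_eq_zero_iff_le
  have hex : ∃ k, s^[k] (e j) = 0 := ⟨j, (hiff j).2 le_rfl⟩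
  have hfind : Nat.find hex = j :=
    (Nat.find_eq_iff hex).2 ⟨(hiff j).2 le_rfl, fun k hk h => hk.not_ge ((hiff k).1 h)⟩
  rw [cost, dif_pos hex, hfind, Finset.sum_Ico_eq_sum_range, Nat.sub_sub_self (by omega)]
  refine Finset.sum_congr rfl fun k hk => ?_
  have hk : k < j := Finset.mem_range.1 hk
  have hin : indeg 0 s (s^[k + 1] (e j)) = 1 := by
    rw [iterate_hamiltonian_path he0 hroot hpath]
    exact indeg_hamiltonian_path he0 hpath ⟨j - (k + 1), by omega⟩
  have hsub : subtreeSize s (s^[k] (e j)) = n - j + k + 1 := by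
    rw [iterate_hamiltonian_path he0 hroot hpath, subtreeSize_hamiltonian_path he0 hroot hpath]
    · simp only
      omega
    · simp only [ne_eq, Fin.ext_iff, Fin.val_zero]
      omega
  rw [hin, hsub]
  push_cast
  rfl

theorem cost_hamiltonian_path_mono (he0 : e 0 = 0) (hroot : s 0 = 0)
    (hpath : ∀ i : Fin n, s (e i.succ) = e i.castSucc) {i j : Fin (n + 1)} (hij : i ≤ j) :
    cost 0 s (e i) ≤ cost 0 s (e j) := by
  rw [cost_hamiltonian_path he0 hroot hpath, cost_hamiltonian_path he0 hroot hpath]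
  have hij : (i : ℕ) ≤ j := hij
  exact Finset.sum_le_sum_of_subset (Finset.Ico_subset_Ico_left (by omega))

end HamiltonianPath

/-- For the directed Hamiltonian path `r = u_0, u_1, …, u_n`
(each agent at `u_i` activating the edge `(u_i, u_{i−1})`, so `u_i` is at distance `i`
from the root), the Fairness Ratio equals `n · H_n`: the maximum cost
`cost(u_n) = H_n = Σ_{i=1}^n 1/i` is attained by the agent farthest from the root and
the minimum cost `cost(u_1) = 1/n` by the agent adjacent to the root. -/
theorem fairness_ratio_of_hamiltonian_path {n : ℕ} (hn : 1 ≤ n)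
    (s : Fin (n + 1) → Fin (n + 1)) (e : Fin (n + 1) ≃ Fin (n + 1))
    (he0 : e 0 = 0) (hroot : s 0 = 0)
    (hpath : ∀ i : Fin n, s (e i.succ) = e i.castSucc) :
    cost 0 s (e (Fin.last n)) = ∑ i ∈ Finset.range n, (1 : ℝ≥0∞) / ((i : ℝ≥0∞) + 1) ∧
    cost 0 s (e ⟨1, by omega⟩) = 1 / (n : ℝ≥0∞) ∧
    (∀ v : Fin (n + 1), v ≠ 0 → cost 0 s v ≤ cost 0 s (e (Fin.last n))) ∧
    (∀ v : Fin (n + 1), v ≠ 0 → cost 0 s (e ⟨1, by omega⟩) ≤ cost 0 s v) ∧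
    FR s = (n : ℝ≥0∞) * ∑ i ∈ Finset.range n, (1 : ℝ≥0∞) / ((i : ℝ≥0∞) + 1) := by
  have hlast : cost 0 s (e (Fin.last n)) =
      ∑ i ∈ Finset.range n, (1 : ℝ≥0∞) / ((i : ℝ≥0∞) + 1) := by
    rw [cost_hamiltonian_path he0 hroot hpath, Fin.val_last, Nat.sub_self, Nat.Ico_zero_eq_range]
  have hfirst : cost 0 s (e ⟨1, by omega⟩) = 1 / (n : ℝ≥0∞) := by
    obtain ⟨m, rfl⟩ := Nat.exists_eq_add_of_le' hn
    rw [cost_hamiltonian_path he0 hroot hpath]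
    simp
  have hmax (v : Fin (n + 1)) : cost 0 s v ≤ cost 0 s (e (Fin.last n)) := by
    obtain ⟨j, rfl⟩ := e.surjective v
    exact cost_hamiltonian_path_mono he0 hroot hpath (Fin.le_last j)
  have hmin (v : Fin (n + 1)) (hv : v ≠ 0) : cost 0 s (e ⟨1, by omega⟩) ≤ cost 0 s v := by
    obtain ⟨j, rfl⟩ := e.surjective v
    refine cost_hamiltonian_path_mono he0 hroot hpath (Fin.le_def.2 ?_)
    exact Nat.one_le_iff_ne_zero.2 fun h => hv ((congrArg e (Fin.ext h)).trans he0)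
  have hne (j : Fin (n + 1)) (hj : (j : ℕ) ≠ 0) : e j ≠ 0 := fun h =>
    hj (congrArg Fin.val (e.injective (h.trans he0.symm)))
  refine ⟨hlast, hfirst, fun v _ => hmax v, hmin, ?_⟩
  have hsup : (⨆ (v : Fin (n + 1)) (_ : v ≠ 0), cost 0 s v) = cost 0 s (e (Fin.last n)) :=
    le_antisymm (iSup₂_le fun v _ => hmax v)
      (le_iSup₂_of_le _ (hne _ (by rw [Fin.val_last]; omega)) le_rfl)
  have hinf : (⨅ (v : Fin (n + 1)) (_ : v ≠ 0), cost 0 s v) = cost 0 s (e ⟨1, by omega⟩) :=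
    le_antisymm (iInf₂_le_of_le _ (hne _ one_ne_zero) le_rfl) (le_iInf₂ hmin)
  rw [FR, hsup, hinf, hlast, hfirst, div_eq_mul_inv, one_div, inv_inv, mul_comm]

end TCG
end
end
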